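/- For every integer k ≥ 2 and every n ∈ N, the digit frequency set DF(n) is a convex subset of Δ. -/

import Mathlib

open Filter Topology
open scoped Classical

namespace BetaDF

/-- Digit sequences (elements of `Σ = {0,…,k−1}^ℕ` when all entries are `< k`). -/
abbrev Seq : Type := ℕ → ℕ

/-- Lexicographic (strict) order on digit sequences. -/
def seqLt (v w : Seq) : Prop := ∃ r, (∀ s, s < r → v s = w s) ∧ v r < w r

/-- Lexicographic order on digit sequences. -/
def seqLe (v w : Seq) : Prop := seqLt v w ∨ v = w

/-- The shift map `σ`. -/
def shift (w : Seq) : Seq := fun r => w (r + 1)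

/-- Membership in `Σ = {0,…,k−1}^ℕ`. -/
def InSigma (k : ℕ) (w : Seq) : Prop := ∀ r, w r < k

/-- A sequence is maximal if it is `≥` every element of its shift orbit. -/
def IsMaximal (w : Seq) : Prop := ∀ r, seqLe (shift^[r] w) w

/-- Number of occurrences of the digit `i` among the first `r` entries of `w`. -/
def digitCount (w : Seq) (i r : ℕ) : ℕ := ((Finset.range r).filter fun s => w s = i).card

/-- The ambient Euclidean space `ℝ^k`. -/
abbrev E (k : ℕ) : Type := EuclideanSpace ℝ (Fin k)

/-- The `i`-th coordinate (with junk value `0` for `i ≥ k`). -/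
def proj {k : ℕ} (α : E k) (i : ℕ) : ℝ := if h : i < k then α ⟨i, h⟩ else 0

/-- `w` has digit frequency vector `α`. -/
def HasDigitFreq (k : ℕ) (w : Seq) (α : E k) : Prop :=
  ∀ i, i < k →
    Tendsto (fun r => (digitCount w i r : ℝ) / (r : ℝ)) atTop (𝓝 (proj α i))

/-- The standard `(k−1)`-simplex `Δ`. -/
def simplex (k : ℕ) : Set (E k) := {α | (∀ i : Fin k, 0 ≤ α i) ∧ ∑ i, α i = 1}

/-- The face `F = {α ∈ Δ : α_{k−1} = 0}`. -/
def faceF (k : ℕ) : Set (E k) := {α ∈ simplex k | proj α (k - 1) = 0}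

/-- `Δ' = Δ ∖ F`. -/
def simplex' (k : ℕ) : Set (E k) := simplex k \ faceF k

/-- `J(α) = ⌊α₀/α_{k−1}⌋`. -/
noncomputable def Jfun {k : ℕ} (α : E k) : ℕ := ⌊proj α 0 / proj α (k - 1)⌋₊

/-- The map `K_n`. -/
noncomputable def Kmap {k : ℕ} (n : ℕ) (α : E k) : E k :=
  (WithLp.equiv 2 (Fin k → ℝ)).symm fun i =>
    if (i : ℕ) + 2 < k then proj α ((i : ℕ) + 1) / (1 - proj α 0)
    else if (i : ℕ) + 2 = k then (proj α 0 - n * proj α (k - 1)) / (1 - proj α 0)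
    else ((n + 1) * proj α (k - 1) - proj α 0) / (1 - proj α 0)

/-- The continued-fraction map `K : Δ' → Δ'`, `K(α) = K_{J(α)}(α)`. -/
noncomputable def Kstep {k : ℕ} (α : E k) : E k := Kmap (Jfun α) α

/-- The itinerary map `Φ(α)_r = J(K^r(α))`. -/
noncomputable def Phi {k : ℕ} (α : E k) : ℕ → ℕ := fun r => Jfun (Kstep^[r] α)

/-- The projective embedding `K_n^{-1} : Δ → Δ`. -/
noncomputable def Kinv {k : ℕ} (n : ℕ) (α : E k) : E k :=
  (WithLp.equiv 2 (Fin k → ℝ)).symm fun i =>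
    (if (i : ℕ) = 0 then (n + 1) * proj α (k - 2) + n * proj α (k - 1)
      else if (i : ℕ) + 1 = k then proj α (k - 2) + proj α (k - 1)
      else proj α ((i : ℕ) - 1)) /
      ((n + 1) * proj α (k - 2) + n * proj α (k - 1) + 1)

/-- `Υ_{n,r} = K_{n₀}^{-1} ∘ ⋯ ∘ K_{n_r}^{-1}`. -/
noncomputable def Ups {k : ℕ} (n : ℕ → ℕ) : ℕ → E k → E k
  | 0 => Kinv (n 0)
  | r + 1 => fun α => Ups n r (Kinv (n (r + 1)) α)

/-- `A_{n,r} = Υ_{n,r}(Δ)`. -/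
noncomputable def Anr (k : ℕ) (n : ℕ → ℕ) (r : ℕ) : Set (E k) := Ups n r '' simplex k

/-- `F_{n,r} = Υ_{n,r}(F)`. -/
noncomputable def Fnr (k : ℕ) (n : ℕ → ℕ) (r : ℕ) : Set (E k) := Ups n r '' faceF k

/-- Reverse-lexicographic strict order on `ℕ^ℕ`: `a < b` iff `a` exceeds `b`
at the first index where they differ. -/
def revLexLt (a b : ℕ → ℕ) : Prop := ∃ r, (∀ s, s < r → a s = b s) ∧ b r < a r

/-- The word to which the substitution `Λ_n` sends the digit `i`. -/
def lamWord (k n i : ℕ) : List ℕ :=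
  if i + 2 < k then [i + 1]
  else if i + 2 = k then (k - 1) :: List.replicate (n + 1) 0
  else (k - 1) :: List.replicate n 0

/-- The substitution `Λ_n : Σ → Σ`. -/
def lamSub (k n : ℕ) (w : Seq) : Seq := fun m =>
  (((List.range (m + 1)).map fun r => lamWord k n (w r)).flatten).getD m 0

/-- `Λ_{n,r} = Λ_{n₀} ∘ ⋯ ∘ Λ_{n_r}`. -/
def lamChain (k : ℕ) (n : ℕ → ℕ) : ℕ → Seq → Seq
  | 0 => lamSub k (n 0)
  | r + 1 => fun w => lamChain k n r (lamSub k (n (r + 1)) w)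

/-- `Λ_{n₀} ∘ ⋯ ∘ Λ_{n_{R−1}}` for a finite list of indices. -/
def lamList (k : ℕ) : List ℕ → Seq → Seq
  | [], w => w
  | a :: t, w => lamSub k a (lamList k t w)

/-- The constant sequence `(k−1)(k−1)(k−1)…`. -/
def topSeq (k : ℕ) : Seq := fun _ => k - 1

/-- The sequence `(k−1)000…`. -/
def baseSeq (k : ℕ) : Seq := fun m => if m = 0 then k - 1 else 0

/-- `S(n) = lim_{r→∞} Λ_{n,r}((k−1)(k−1)(k−1)…)` (limit in the product topology). -/
noncomputable def Sseq (k : ℕ) (n : ℕ → ℕ) : Seq :=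
  limUnder atTop fun r => lamChain k n r (topSeq k)

/-- The compactified itinerary space `N`: sequences with values in `ℕ∞` such that
all entries from the first `∞` onwards equal `∞`.  Elements with no `∞` entry
correspond to `ℕ^ℕ`; the others are the finite type elements `n₀…n_{R−1}∞`. -/
def NN : Type := {m : ℕ → ℕ∞ // ∀ r, m r = ⊤ → m (r + 1) = ⊤}

/-- Reverse-lexicographic strict order on `N` (`∞` counts as larger than every natural). -/
def nnLt (m n : NN) : Prop := ∃ r, (∀ s, s < r → m.1 s = n.1 s) ∧ n.1 r < m.1 r

/-- Reverse-lexicographic order on `N`. -/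
def nnLe (m n : NN) : Prop := nnLt m n ∨ m = n

/-- The element of `N` determined by an element of `ℕ^ℕ`. -/
def toNN (g : ℕ → ℕ) : NN := ⟨fun r => (g r : ℕ∞), fun r h => absurd h (by simp)⟩

/-- The itinerary `n₀ … n_{R−1} (n_R + 1) 0 0 0 …` (of rational type). -/
def ratSeq (f : ℕ → ℕ) (R : ℕ) : ℕ → ℕ := fun r =>
  if r < R then f r else if r = R then f R + 1 else 0

/-- The finite type element `n₀ … n_{R−1} n_R ∞` of `N`. -/
def finNN (f : ℕ → ℕ) (R : ℕ) : NN :=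
  ⟨fun r => if r ≤ R then (f r : ℕ∞) else ⊤, by
    intro r h
    show (if r + 1 ≤ R then ((f (r + 1) : ℕ∞)) else ⊤) = ⊤
    have h' : (if r ≤ R then ((f r : ℕ∞)) else ⊤) = ⊤ := h
    by_cases h1 : r ≤ R
    · rw [if_pos h1] at h'
      exact absurd h' (by simp)
    · rw [if_neg (by omega : ¬ r + 1 ≤ R)]⟩

/-- The extension of `S` to `N`. -/
noncomputable def SN (k : ℕ) (m : NN) : Seq :=
  if h : ∃ R, m.1 R = ⊤ then
    lamList k ((List.range (Nat.find h)).map fun r => (m.1 r).toNat) (baseSeq k)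
  else Sseq k fun r => (m.1 r).toNat

/-- The metric `d(m,n) = 2^{−X(m,n)}` on `N`, where
`X(m,n) = r + min(m₀+⋯+m_r, n₀+⋯+n_r)` and `r` is the first index where `m,n` differ. -/
noncomputable def dN (m n : NN) : ℝ :=
  if h : m = n then 0
  else
    have hex : ∃ r, m.1 r ≠ n.1 r := by
      by_contra hc
      push_neg at hc
      exact h (Subtype.ext (funext hc))
    (2 : ℝ) ^ (-(((Nat.find hex : ℕ) : ℤ) +
      ((min (∑ s ∈ Finset.range (Nat.find hex + 1), m.1 s)
            (∑ s ∈ Finset.range (Nat.find hex + 1), n.1 s)).toNat : ℤ)))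

/-- The symbolic β-shift `X(w)`. -/
def Xset (k : ℕ) (w : Seq) : Set Seq :=
  {v | InSigma k v ∧ ∀ r, seqLe (shift^[r] v) w}

/-- The digit frequency set `DF(w)` of the symbolic β-shift `X(w)`. -/
def DFw (k : ℕ) (w : Seq) : Set (E k) :=
  {α | α ∈ simplex k ∧ ∃ v ∈ Xset k w, HasDigitFreq k v α}

/-- `DF(n) = DF(S(n))` for `n ∈ ℕ^ℕ`. -/
noncomputable def DFn (k : ℕ) (n : ℕ → ℕ) : Set (E k) := DFw k (Sseq k n)

/-- `DF(n) = DF(S(n))` for `n ∈ N`. -/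
noncomputable def DFN (k : ℕ) (m : NN) : Set (E k) := DFw k (SN k m)

/-- The infimax map `I = S ∘ Φ` on `Δ'`, extended by `I(α) = (k−1)000…` on `F`. -/
noncomputable def Ifun (k : ℕ) (α : E k) : Seq :=
  if α ∈ simplex' k then Sseq k (Phi α) else baseSeq k

/-- The simplex `T_m = {α ∈ Δ : (m+1)α_{k−1} ≤ α₀}`. -/
def Tset (k m : ℕ) : Set (E k) :=
  {α ∈ simplex k | ((m : ℝ) + 1) * proj α (k - 1) ≤ proj α 0}

/-- The standard basis vector `e_i`. -/
noncomputable def evec (k i : ℕ) : E k :=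
  (WithLp.equiv 2 (Fin k → ℝ)).symm fun j => if (j : ℕ) = i then 1 else 0

/-- The rational extreme points
`FE(n) = {Υ_{n,s}(e_{k−2}) : n_{s+t} ≠ 0 for some 1 ≤ t ≤ k−2}`. -/
noncomputable def FEset (k : ℕ) (n : ℕ → ℕ) : Set (E k) :=
  {α | ∃ s, (∃ t, 1 ≤ t ∧ t ≤ k - 2 ∧ n (s + t) ≠ 0) ∧ α = Ups n s (evec k (k - 2))}

/-- The set `E(n)` of non-trivial extreme points of `DF(n)`:
extreme points other than `e₀,…,e_{k−2}`. -/
noncomputable def Eset (k : ℕ) (n : ℕ → ℕ) : Set (E k) :=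
  Set.extremePoints ℝ (DFn k n) \ {α | ∃ i, i ≤ k - 2 ∧ α = evec k i}

/-- The fiber `Φ^{-1}(n) ⊆ Δ'`. -/
noncomputable def PhiFiber (k : ℕ) (n : ℕ → ℕ) : Set (E k) :=
  {α ∈ simplex' k | Phi α = n}

/-- `f_β(x) = βx mod 1`. -/
noncomputable def fbeta (β x : ℝ) : ℝ := Int.fract (β * x)

/-- The digit sequence of the greedy β-expansion of `x`: `d_β(x)_r = ⌊β f_β^r(x)⌋`. -/
noncomputable def dbeta (β : ℝ) (x : ℝ) : Seq := fun r => ⌊β * (fbeta β)^[r] x⌋₊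

/-- The digit frequency set `DF(β)` of β-expansions of points of `[0,1]`. -/
noncomputable def DFbeta (k : ℕ) (β : ℝ) : Set (E k) :=
  {α | α ∈ simplex k ∧ ∃ x ∈ Set.Icc (0 : ℝ) 1, HasDigitFreq k (dbeta β x) α}

/-- The sequence `w_β`: if `d_β(1) = d₁…d_{r−1}d_r000…` with `d_r > 0` then `w_β`
is the infinite repetition of `d₁…d_{r−1}(d_r − 1)`; otherwise `w_β = d_β(1)`. -/
noncomputable def wbeta (β : ℝ) : Seq :=
  if h : ∃ r, dbeta β 1 r ≠ 0 ∧ ∀ s, r < s → dbeta β 1 s = 0 then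
    fun m =>
      if m % (Nat.find h + 1) = Nat.find h then dbeta β 1 (Nat.find h) - 1
      else dbeta β 1 (m % (Nat.find h + 1))
  else dbeta β 1

/-- `DF` extended to `[k−1,k]` by `DF(k−1) = F` and `DF(k) = Δ`. -/
noncomputable def DFext (k : ℕ) (β : ℝ) : Set (E k) :=
  if β ≤ (k : ℝ) - 1 then faceF k
  else if (k : ℝ) ≤ β then simplex k
  else DFbeta k β

/-- The mode-locking interval `I_{n₀…n_R}` determined by the word `f 0, …, f R`. -/
noncomputable def Iint (k : ℕ) (f : ℕ → ℕ) (R : ℕ) : Set ℝ :=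
  {β | (k : ℝ) - 1 < β ∧ β < k ∧
    seqLe (Sseq k (ratSeq f R)) (wbeta β) ∧ seqLe (wbeta β) (SN k (finNN f R))}

/-- The frequency vector of the first `s` digits of `w`. -/
noncomputable def freqVec (k : ℕ) (w : Seq) (s : ℕ) : E k :=
  (WithLp.equiv 2 (Fin k → ℝ)).symm fun i => (digitCount w (i : ℕ) s : ℝ) / (s : ℝ)


theorem shift_iter (v : Seq) (r s : ℕ) : (shift^[r] v) s = v (r + s) := by
  induction r generalizing s with
  | zero => simp
  | succ r ih =>
    rw [Function.iterate_succ_apply']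
    show (shift^[r] v) (s + 1) = _
    rw [ih]; congr 1; omega

theorem seqLt_trans_le {x y w : Seq} (h : seqLt x y) (h' : seqLe y w) : seqLt x w := by
  rcases h' with h' | rfl
  · obtain ⟨p, hp, hp'⟩ := h
    obtain ⟨q, hq, hq'⟩ := h'
    rcases lt_trichotomy p q with h1 | h1 | h1
    · exact ⟨p, fun s hs => (hp s hs).trans (hq s (hs.trans h1)), (hq p h1) ▸ hp'⟩
    · subst h1
      exact ⟨p, fun s hs => (hp s hs).trans (hq s hs), hp'.trans hq'⟩
    · exact ⟨q, fun s hs => (hp s (hs.trans h1)).trans (hq s hs), by rw [hp q h1]; exact hq'⟩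
  · exact h

theorem le_head {k : ℕ} {v w : Seq} (h : v ∈ Xset k w) (r : ℕ) : v r ≤ w 0 := by
  have h0 : v r = (shift^[r] v) 0 := by rw [shift_iter]; rfl
  rw [h0]
  rcases h.2 r with ⟨q, hq, hq'⟩ | h1
  · rcases Nat.eq_zero_or_pos q with rfl | hp
    · exact hq'.le
    · exact (hq 0 hp).le
  · rw [h1]

/-- Greedy number of entries read from the first sequence before block `m`. -/
noncomputable def Dg (t : ℝ) : ℕ → ℕ
  | 0 => 0
  | m + 1 => Dg t m + if (Dg t m : ℝ) ≤ t * (m : ℝ) ^ 2 then 2 * m + 1 else 0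

/-- In which blocks the first sequence is read. -/
def cg (t : ℝ) (m : ℕ) : Prop := (Dg t m : ℝ) ≤ t * (m : ℝ) ^ 2

/-- Number of entries read from the first sequence before time `r`. -/
noncomputable def Ag (t : ℝ) (r : ℕ) : ℕ :=
  Dg t (Nat.sqrt r) + if cg t (Nat.sqrt r) then r - Nat.sqrt r ^ 2 else 0

theorem sqrt_eq_of {m r : ℕ} (h : m ^ 2 ≤ r) (h' : r < (m + 1) ^ 2) : Nat.sqrt r = m := by
  rw [Nat.eq_sqrt'.2 ⟨h, h'⟩]

theorem sqrt_lo (r : ℕ) : Nat.sqrt r ^ 2 ≤ r := Nat.sqrt_le' r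
theorem sqrt_hi (r : ℕ) : r < (Nat.sqrt r + 1) ^ 2 := Nat.lt_succ_sqrt' r

theorem Ag_succ (t : ℝ) (r : ℕ) :
    Ag t (r + 1) = Ag t r + if cg t (Nat.sqrt r) then 1 else 0 := by
  have h1 := sqrt_lo r
  have h2 := sqrt_hi r
  by_cases h : r + 1 < (Nat.sqrt r + 1) ^ 2
  · have h3 : Nat.sqrt (r + 1) = Nat.sqrt r := sqrt_eq_of (by omega) h
    unfold Ag
    rw [h3]
    split_ifs <;> omega
  · have h4 : r + 1 = (Nat.sqrt r + 1) ^ 2 := by omega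
    have h3 : Nat.sqrt (r + 1) = Nat.sqrt r + 1 := by
      apply sqrt_eq_of
      · omega
      · rw [h4]; exact Nat.pow_lt_pow_left (by omega) (by omega)
    unfold Ag
    rw [h3]
    generalize Nat.sqrt r = m at *
    have h5 : (m + 1) ^ 2 = m ^ 2 + 2 * m + 1 := by ring
    have h6 : Dg t (m + 1) = Dg t m + if cg t m then 2 * m + 1 else 0 := rfl
    rw [h6]
    split_ifs <;> omega

theorem Ag_zero (t : ℝ) : Ag t 0 = 0 := by simp [Ag, Dg]

theorem Ag_le (t : ℝ) (r : ℕ) : Ag t r ≤ r := by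
  induction r with
  | zero => simp [Ag_zero]
  | succ r ih => rw [Ag_succ]; split_ifs <;> omega

theorem Dg_bound {t : ℝ} (h0 : 0 ≤ t) (h1 : t ≤ 1) (m : ℕ) :
    |(Dg t m : ℝ) - t * (m : ℝ) ^ 2| ≤ 2 * m + 1 := by
  induction m with
  | zero => simp [Dg]
  | succ m ih =>
    rw [abs_le] at ih ⊢
    have hm : (0 : ℝ) ≤ m := Nat.cast_nonneg m
    have h6 : t * (2 * m + 1) ≤ 1 * (2 * m + 1) := by gcongr
    have h7 : 0 ≤ t * (2 * m + 1) := by positivity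
    unfold Dg
    split_ifs with h
    · push_cast
      constructor <;> nlinarith
    · push_cast
      constructor <;> nlinarith

theorem Ag_bound {t : ℝ} (h0 : 0 ≤ t) (h1 : t ≤ 1) (r : ℕ) :
    |(Ag t r : ℝ) - t * r| ≤ 4 * Nat.sqrt r + 4 := by
  have hD := Dg_bound h0 h1 (Nat.sqrt r)
  have e1 := sqrt_lo r
  have e2 := sqrt_hi r
  have e1' : ((Nat.sqrt r : ℕ) : ℝ) ^ 2 ≤ r := by exact_mod_cast e1
  have e2' : (r : ℝ) ≤ ((Nat.sqrt r : ℕ) + 1 : ℝ) ^ 2 := by exact_mod_cast e2.le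
  unfold Ag
  generalize Nat.sqrt r = m at *
  rw [abs_le] at hD ⊢
  have hm : (0 : ℝ) ≤ m := Nat.cast_nonneg m
  have h6 : t * (r - (m : ℝ) ^ 2) ≤ 1 * (r - (m : ℝ) ^ 2) := by
    apply mul_le_mul_of_nonneg_right h1; linarith
  have h7 : 0 ≤ t * (r - (m : ℝ) ^ 2) := mul_nonneg h0 (by linarith)
  split_ifs with h
  · push_cast [Nat.cast_sub e1]
    constructor <;> nlinarith
  · push_cast
    constructor <;> nlinarith

theorem tendsto_err : Tendsto (fun r : ℕ => (4 * (Nat.sqrt r : ℝ) + 4) / r) atTop (𝓝 0) := by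
  have hA : Tendsto (fun r : ℕ => 4 * (Real.sqrt r)⁻¹ + 4 * (r : ℝ)⁻¹) atTop (𝓝 (4 * 0 + 4 * 0)) := by
    apply Tendsto.add
    · exact ((tendsto_inv_atTop_zero.comp
        (Real.tendsto_sqrt_atTop.comp tendsto_natCast_atTop_atTop))).const_mul 4
    · exact (tendsto_inv_atTop_zero.comp tendsto_natCast_atTop_atTop).const_mul 4
  simp only [mul_zero, add_zero] at hA
  refine squeeze_zero (fun r => by positivity) (fun r => ?_) hA
  have h1 : (Nat.sqrt r : ℝ) ≤ Real.sqrt r := Real.nat_sqrt_le_real_sqrt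
  have h2 : (Real.sqrt r)⁻¹ = Real.sqrt r / r := by
    rw [Real.sqrt_div_self', one_div]
  rw [h2]
  calc (4 * (Nat.sqrt r : ℝ) + 4) / r ≤ (4 * Real.sqrt r + 4) / r := by gcongr
    _ = _ := by ring

theorem tendsto_of_err {f : ℕ → ℝ} {L : ℝ}
    (h : ∀ r : ℕ, |f r - L * r| ≤ 4 * (Nat.sqrt r : ℝ) + 4) :
    Tendsto (fun r : ℕ => f r / r) atTop (𝓝 L) := by
  rw [tendsto_iff_norm_sub_tendsto_zero]
  refine squeeze_zero' (Eventually.of_forall fun r => norm_nonneg _) ?_ tendsto_err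
  filter_upwards [eventually_gt_atTop 0] with r hr
  have hr' : (0 : ℝ) < r := by exact_mod_cast hr
  have : f r / r - L = (f r - L * r) / r := by field_simp
  rw [this, Real.norm_eq_abs, abs_div, abs_of_pos hr']
  gcongr
  exact h r

/-- Interleaving of two sequences, without corrections. -/
noncomputable def mix (t : ℝ) (v v' : Seq) : Seq := fun r =>
  if cg t (Nat.sqrt r) then v (Ag t r) else v' (r - Ag t r)

/-- The last nonzero entry of a block. -/
def modif (x : Seq) (r : ℕ) : Prop :=
  0 < x r ∧ ∀ s, r < s → Nat.sqrt s = Nat.sqrt r → x s = 0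

/-- Decrease the last nonzero entry of each block. -/
noncomputable def corr (x : Seq) : Seq := fun r => if modif x r then x r - 1 else x r

theorem Ag_add (t : ℝ) (r s : ℕ) (h : Nat.sqrt (r + s) = Nat.sqrt r) :
    Ag t (r + s) = Ag t r + if cg t (Nat.sqrt r) then s else 0 := by
  have := sqrt_lo r
  unfold Ag
  rw [h]
  split_ifs <;> omega

theorem mix_block {k : ℕ} {w v v' : Seq} (t : ℝ) (hv : v ∈ Xset k w) (hv' : v' ∈ Xset k w) (r : ℕ) :
    ∃ y : Seq, seqLe y w ∧ ∀ s, Nat.sqrt (r + s) = Nat.sqrt r → mix t v v' (r + s) = y s := by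
  by_cases h : cg t (Nat.sqrt r)
  · refine ⟨_, hv.2 (Ag t r), fun s hs => ?_⟩
    rw [shift_iter]
    simp only [mix, hs, if_pos h, Ag_add t r s hs]
  · refine ⟨_, hv'.2 (r - Ag t r), fun s hs => ?_⟩
    rw [shift_iter]
    have := Ag_le t r
    simp only [mix, hs, if_neg h, Ag_add t r s hs]
    congr 1; omega

theorem corr_mem {k : ℕ} {w v v' : Seq} (t : ℝ) (hw : 0 < w 0)
    (hv : v ∈ Xset k w) (hv' : v' ∈ Xset k w) : corr (mix t v v') ∈ Xset k w := by
  constructor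
  · intro r
    have h : mix t v v' r < k := by
      unfold mix; split_ifs
      · exact hv.1 _
      · exact hv'.1 _
    unfold corr
    split_ifs <;> omega
  · intro r
    left
    obtain ⟨y, hy, hyx⟩ := mix_block t hv hv' r
    set x := mix t v v' with hx
    have hfin : ∀ s, Nat.sqrt (r + s) = Nat.sqrt r → s ≤ (Nat.sqrt r + 1) ^ 2 := by
      intro s hs
      have := sqrt_hi (r + s)
      rw [hs] at this; omega
    by_cases hz : ∃ s, Nat.sqrt (r + s) = Nat.sqrt r ∧ 0 < x (r + s)
    · obtain ⟨s0, hs0⟩ := hz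
      let P : ℕ → Prop := fun s => Nat.sqrt (r + s) = Nat.sqrt r ∧ 0 < x (r + s)
      let q := Nat.findGreatest P ((Nat.sqrt r + 1) ^ 2)
      have hq : P q := Nat.findGreatest_spec (P := P) (hfin s0 hs0.1) hs0
      have hgr : ∀ s, q < s → ¬ P s := by
        intro s hs hP
        exact absurd (Nat.le_findGreatest (hfin s hP.1) hP) (by omega)
      refine seqLt_trans_le ?_ hy
      refine ⟨q, fun s hs => ?_, ?_⟩
      · have e : Nat.sqrt (r + s) = Nat.sqrt r := by
          apply le_antisymm
          · rw [← hq.1]; exact Nat.sqrt_le_sqrt (by omega)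
          · exact Nat.sqrt_le_sqrt (by omega)
        rw [shift_iter, ← hyx s e]
        unfold corr
        rw [if_neg]
        rintro ⟨_, h2⟩
        have h3 := h2 (r + q) (by omega) (by rw [hq.1, e])
        have h4 := hq.2
        omega
      · have hm : modif x (r + q) := by
          refine ⟨hq.2, fun s hs hs' => ?_⟩
          by_contra hne
          apply hgr (s - r) (by omega)
          have e : r + (s - r) = s := by omega
          refine ⟨?_, ?_⟩
          · rw [e, hs', hq.1]
          · rw [e]; omega
        rw [shift_iter, ← hyx q hq.1]
        unfold corr
        rw [if_pos hm]
        have := hq.2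
        omega
    · push Not at hz
      refine ⟨0, fun s hs => absurd hs (by omega), ?_⟩
      rw [shift_iter]
      have := hz 0 rfl
      unfold corr
      split_ifs <;> omega

theorem count_succ (w : Seq) (i r : ℕ) :
    digitCount w i (r + 1) = digitCount w i r + if w r = i then 1 else 0 := by
  unfold digitCount
  rw [Finset.range_add_one, Finset.filter_insert]
  split_ifs with h
  · rw [Finset.card_insert_of_notMem (by simp)]
  · simp

theorem mix_count (t : ℝ) (v v' : Seq) (i r : ℕ) :
    digitCount (mix t v v') i r = digitCount v i (Ag t r) + digitCount v' i (r - Ag t r) := by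
  induction r with
  | zero => simp [Ag_zero, digitCount]
  | succ r ih =>
    have hle := Ag_le t r
    rw [count_succ, ih, Ag_succ]
    by_cases h : cg t (Nat.sqrt r)
    · have e : r + 1 - (Ag t r + 1) = r - Ag t r := by omega
      simp only [mix, if_pos h]
      rw [e, count_succ]; omega
    · have e : r + 1 - (Ag t r + 0) = r - Ag t r + 1 := by omega
      simp only [mix, if_neg h]
      rw [e, count_succ]; simp only [add_zero]; omega

theorem modif_card (x : Seq) (r : ℕ) :
    ((Finset.range r).filter fun s => modif x s).card ≤ Nat.sqrt r + 1 := by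
  rw [← Finset.card_range (Nat.sqrt r + 1)]
  apply Finset.card_le_card_of_injOn Nat.sqrt
  · intro s hs
    simp only [Finset.coe_filter, Finset.mem_range, Set.mem_setOf_eq, Finset.coe_range,
      Set.mem_Iio] at hs ⊢
    have := Nat.sqrt_le_sqrt hs.1.le
    omega
  · intro a ha b hb hab
    simp only [Finset.coe_filter, Finset.mem_range, Set.mem_setOf_eq] at ha hb
    by_contra hne
    rcases lt_or_gt_of_ne hne with h | h
    · have h1 := ha.2.2 b h hab.symm
      have h2 := hb.2.1
      omega
    · have h1 := hb.2.2 a h hab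
      have h2 := ha.2.1
      omega

theorem corr_count (x : Seq) (i r : ℕ) :
    |(digitCount (corr x) i r : ℝ) - digitCount x i r| ≤ 4 * Nat.sqrt r + 4 := by
  have hc := modif_card x r
  have key : digitCount (corr x) i r ≤
        digitCount x i r + ((Finset.range r).filter fun s => modif x s).card ∧
      digitCount x i r ≤
        digitCount (corr x) i r + ((Finset.range r).filter fun s => modif x s).card := by
    unfold digitCount
    constructor
    · refine le_trans (Finset.card_le_card ?_) (Finset.card_union_le _ _)
      intro s
      have e : ¬ modif x s → corr x s = x s := fun h => by simp [corr, h]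
      simp only [Finset.mem_union, Finset.mem_filter]
      by_cases h : modif x s
      · tauto
      · rw [e h]; tauto
    · refine le_trans (Finset.card_le_card ?_) (Finset.card_union_le _ _)
      intro s
      have e : ¬ modif x s → corr x s = x s := fun h => by simp [corr, h]
      simp only [Finset.mem_union, Finset.mem_filter]
      by_cases h : modif x s
      · tauto
      · rw [e h]; tauto
  have k1 : (digitCount (corr x) i r : ℝ) ≤ digitCount x i r + (Nat.sqrt r + 1) := by
    have : digitCount (corr x) i r ≤ digitCount x i r + (Nat.sqrt r + 1) := by omega
    exact_mod_cast this
  have k2 : (digitCount x i r : ℝ) ≤ digitCount (corr x) i r + (Nat.sqrt r + 1) := by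
    have : digitCount x i r ≤ digitCount (corr x) i r + (Nat.sqrt r + 1) := by omega
    exact_mod_cast this
  have h0 : (0 : ℝ) ≤ Nat.sqrt r := Nat.cast_nonneg _
  rw [abs_le]; constructor <;> linarith

theorem sub_freq {f : ℕ → ℕ} {B : ℕ → ℕ} {b L : ℝ} (hb : 0 < b)
    (hB : Tendsto (fun r : ℕ => (B r : ℝ) / r) atTop (𝓝 b))
    (hf : Tendsto (fun r : ℕ => (f r : ℝ) / r) atTop (𝓝 L)) :
    Tendsto (fun r : ℕ => (f (B r) : ℝ) / r) atTop (𝓝 (b * L)) := by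
  have hBt : Tendsto B atTop atTop := by
    rw [← tendsto_natCast_atTop_iff (R := ℝ)]
    have := hB.pos_mul_atTop hb (tendsto_natCast_atTop_atTop (R := ℝ))
    refine this.congr' ?_
    filter_upwards [eventually_gt_atTop 0] with r hr
    have hr' : (0 : ℝ) < r := by exact_mod_cast hr
    field_simp
  refine (hB.mul (hf.comp hBt)).congr' ?_
  filter_upwards [hBt.eventually_gt_atTop 0] with r hr
  have hr' : (0 : ℝ) < B r := by exact_mod_cast hr
  simp only [Function.comp]
  field_simp

theorem simplex_convex (k : ℕ) : Convex ℝ (simplex k) := by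
  intro x hx y hy a b ha hb hab
  refine ⟨fun i => ?_, ?_⟩
  · have := hx.1 i
    have := hy.1 i
    simp only [PiLp.add_apply, PiLp.smul_apply, smul_eq_mul]
    positivity
  · simp only [PiLp.add_apply, PiLp.smul_apply, smul_eq_mul, Finset.sum_add_distrib,
      ← Finset.mul_sum]
    rw [hx.2, hy.2]; linarith

theorem DFw_convex (k : ℕ) (w : Seq) : Convex ℝ (DFw k w) := by
  rw [convex_iff_forall_pos]
  rintro x ⟨hx, v, hv, hvx⟩ y ⟨hy, v', hv', hvy⟩ a b ha hb hab
  refine ⟨simplex_convex k hx hy ha.le hb.le hab, ?_⟩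
  have hproj : ∀ i, proj (a • x + b • y) i = a * proj x i + b * proj y i := by
    intro i
    unfold proj
    split_ifs <;> simp
  by_cases hw : 0 < w 0
  · refine ⟨corr (mix a v v'), corr_mem a hw hv hv', ?_⟩
    intro i hi
    have hA : Tendsto (fun r : ℕ => (Ag a r : ℝ) / r) atTop (𝓝 a) :=
      tendsto_of_err (Ag_bound ha.le (by linarith))
    have hA' : Tendsto (fun r : ℕ => ((r - Ag a r : ℕ) : ℝ) / r) atTop (𝓝 b) := by
      apply tendsto_of_err
      intro r
      have h1 := Ag_bound ha.le (by linarith : a ≤ 1) r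
      rw [Nat.cast_sub (Ag_le a r)]
      rw [← abs_neg] at h1
      convert h1 using 2
      have : b = 1 - a := by linarith
      rw [this]; ring
    have h1 := sub_freq ha hA (hvx i hi)
    have h2 := sub_freq hb hA' (hvy i hi)
    have h3 : Tendsto (fun r : ℕ => ((digitCount (corr (mix a v v')) i r : ℝ)
        - digitCount (mix a v v') i r) / r) atTop (𝓝 0) := by
      apply tendsto_of_err
      intro r
      simpa using corr_count (mix a v v') i r
    have h4 := (h1.add h2).add h3
    rw [hproj]
    rw [add_zero] at h4
    refine h4.congr fun r => ?_
    rw [mix_count]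
    push_cast
    ring
  · have e : v = v' := by
      funext r
      have := le_head hv r
      have := le_head hv' r
      omega
    subst e
    refine ⟨v, hv, fun i hi => ?_⟩
    rw [hproj, tendsto_nhds_unique (hvy i hi) (hvx i hi), ← add_mul, hab, one_mul]
    exact hvx i hi

/-- `DF(n)` is convex for every `n ∈ N`. -/
theorem stmt5 (k : ℕ) (hk : 2 ≤ k) (m : NN) : Convex ℝ (DFN k m) := by
  exact DFw_convex k _

end BetaDF
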